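/- arXiv:1502.02420 — 7 statements merged into one kernel-verified Lean document; each statement's English description precedes it below -/
import Mathlib

section
/- For every integer n ≥ 1 and every abelian subgroup A of the Heisenberg group H(ℤ/nℤ), the index [H(ℤ/nℤ) : A] is at least n. -/
/-- The Heisenberg group over a commutative ring `R`: upper unitriangular 3×3
matrices `A(x,y,z) = [[1,x,z],[0,1,y],[0,0,1]]`, recorded via their entries,
with the multiplication induced by matrix multiplication. -/
@[ext] structure Heisenberg (R : Type*) [CommRing R] where
  x : R
  y : R
  z : R

namespace Heisenberg

variable {R : Type*} [CommRing R]

instance : Mul (Heisenberg R) :=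
  ⟨fun a b => ⟨a.x + b.x, a.y + b.y, a.z + b.z + a.x * b.y⟩⟩

instance : One (Heisenberg R) := ⟨⟨0, 0, 0⟩⟩

instance : Inv (Heisenberg R) := ⟨fun a => ⟨-a.x, -a.y, a.x * a.y - a.z⟩⟩

@[simp] lemma mul_x (a b : Heisenberg R) : (a * b).x = a.x + b.x := rfl
@[simp] lemma mul_y (a b : Heisenberg R) : (a * b).y = a.y + b.y := rfl
@[simp] lemma mul_z (a b : Heisenberg R) : (a * b).z = a.z + b.z + a.x * b.y := rfl
@[simp] lemma one_x : (1 : Heisenberg R).x = 0 := rfl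
@[simp] lemma one_y : (1 : Heisenberg R).y = 0 := rfl
@[simp] lemma one_z : (1 : Heisenberg R).z = 0 := rfl
@[simp] lemma inv_x (a : Heisenberg R) : (a⁻¹).x = -a.x := rfl
@[simp] lemma inv_y (a : Heisenberg R) : (a⁻¹).y = -a.y := rfl
@[simp] lemma inv_z (a : Heisenberg R) : (a⁻¹).z = a.x * a.y - a.z := rfl

instance : Group (Heisenberg R) where
  mul_assoc a b c := by ext <;> simp <;> ring_nf
  one_mul a := by ext <;> simp
  mul_one a := by ext <;> simp
  inv_mul_cancel a := by ext <;> simp [mul_comm]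

/-- The matrix realisation of an element of the Heisenberg group. -/
def toMatrix (a : Heisenberg R) : Matrix (Fin 3) (Fin 3) R :=
  !![1, a.x, a.z; 0, 1, a.y; 0, 0, 1]

end Heisenberg

namespace Heisenberg

/-- The Heisenberg group is in bijection with triples of ring elements. -/
def equivProd (R : Type*) [CommRing R] : Heisenberg R ≃ R × R × R where
  toFun a := (a.x, a.y, a.z)
  invFun t := ⟨t.1, t.2.1, t.2.2⟩
  left_inv _ := rfl
  right_inv _ := rfl

/-- The entry `x`, as a homomorphism to the additive group of the ring. -/
def xHom (R : Type*) [CommRing R] : Heisenberg R →* Multiplicative R where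
  toFun a := Multiplicative.ofAdd a.x
  map_one' := rfl
  map_mul' _ _ := rfl

theorem card_eq (R : Type*) [CommRing R] : Nat.card (Heisenberg R) = Nat.card R ^ 3 := by
  rw [Nat.card_congr (equivProd R), Nat.card_prod, Nat.card_prod]
  ring

theorem commute_iff {R : Type*} [CommRing R] {a b : Heisenberg R} :
    a * b = b * a ↔ a.x * b.y = b.x * a.y := by
  constructor
  · intro h
    have := congrArg Heisenberg.z h
    simp only [mul_z] at this
    linear_combination this
  · intro h
    ext
    · exact add_comm _ _
    · exact add_comm _ _
    · simp only [mul_z]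
      linear_combination h

/-- An abelian subgroup of the Heisenberg group over a finite ring with cyclic additive group
has at most `|R|²` elements. -/
theorem card_le_sq {R : Type*} [CommRing R] [Finite R] [IsAddCyclic R]
    (A : Subgroup (Heisenberg R)) (hA : ∀ a ∈ A, ∀ b ∈ A, a * b = b * a) :
    Nat.card A ≤ Nat.card R ^ 2 := by
  let f : A →* Multiplicative R := (xHom R).comp A.subtype
  obtain ⟨⟨_, a, rfl⟩, hg⟩ := IsCyclic.exists_generator (α := f.range)
  let m : R →+ R := AddMonoidHom.mulLeft a.1.x
  have hrange : Nat.card f.range ≤ Nat.card m.range := by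
    refine Nat.card_le_card_of_injective
      (fun t => ⟨Multiplicative.toAdd t.1, ?_⟩) fun s t h => ?_
    · obtain ⟨k, hk⟩ := Subgroup.mem_zpowers_iff.mp (hg t)
      refine ⟨(k : R), ?_⟩
      rw [← hk]
      change a.1.x * (k : R) = k • a.1.x
      rw [zsmul_eq_mul, mul_comm]
    · exact Subtype.ext (congrArg Subtype.val h :)
  have hx (b : f.ker) : b.1.1.x = 0 := b.2
  have hker : Nat.card f.ker ≤ Nat.card m.ker * Nat.card R := by
    rw [← Nat.card_prod]
    refine Nat.card_le_card_of_injective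
      (fun b => (⟨b.1.1.y, ?_⟩, b.1.1.z)) fun b c h => ?_
    · have h := commute_iff.mp (hA a.1 a.2 b.1.1 b.1.2)
      rwa [hx b, zero_mul] at h
    · obtain ⟨hy, hz⟩ := Prod.ext_iff.mp h
      exact Subtype.ext <| Subtype.ext <|
        Heisenberg.ext ((hx b).trans (hx c).symm) (congrArg Subtype.val hy :) hz
  have hf : Nat.card f.ker * Nat.card f.range = Nat.card A := by
    rw [← Subgroup.index_ker, Subgroup.card_mul_index]
  have hm : Nat.card m.ker * Nat.card m.range = Nat.card R := by
    rw [← AddSubgroup.index_ker, AddSubgroup.card_mul_index]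
  calc Nat.card A = Nat.card f.ker * Nat.card f.range := hf.symm
    _ ≤ Nat.card m.ker * Nat.card R * Nat.card m.range := Nat.mul_le_mul hker hrange
    _ = Nat.card R ^ 2 := by rw [mul_right_comm, hm, sq]

end Heisenberg

/-- For every `n ≥ 1`, every abelian subgroup of the Heisenberg group
`H(ℤ/nℤ)` has index at least `n`. -/
theorem abelian_subgroup_heisenberg_index_ge
    (n : ℕ) (hn : 1 ≤ n) (A : Subgroup (Heisenberg (ZMod n)))
    (hA : ∀ a ∈ A, ∀ b ∈ A, a * b = b * a) :
    n ≤ A.index := by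
  have : NeZero n := ⟨by omega⟩
  have hcard := Heisenberg.card_le_sq A hA
  have hmul := A.card_mul_index
  rw [Heisenberg.card_eq] at hmul
  rw [Nat.card_zmod] at hcard hmul
  refine Nat.le_of_mul_le_mul_left ?_ (pow_pos hn 2)
  calc n ^ 2 * n = Nat.card A * A.index := by rw [hmul, pow_succ n 2]
    _ ≤ n ^ 2 * A.index := Nat.mul_le_mul_right _ hcard
end

section
/- The map h : H(ℝ) → H(ℝ) defined by h(A(x,y,z)) = A(−y, x+y, z − xy − y²/2) is a group automorphism of the real Heisenberg group satisfying h⁶ = id. Moreover, for every even positive integer n, h maps the subgroup T(ℤ,nℤ) = {A(x,y,z) : x,y,z ∈ nℤ} bijectively onto itself. -/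
/-- The map `h(A(x,y,z)) = A(−y, x+y, z − xy − y²/2)` is a group automorphism
of the real Heisenberg group with `h⁶ = id`, and for every even positive
integer `n` it maps the subgroup `T(ℤ,nℤ)` bijectively onto itself. -/
theorem heisenberg_real_automorphism_h
    (h : Heisenberg ℝ → Heisenberg ℝ)
    (hdef : ∀ x y z : ℝ, h ⟨x, y, z⟩ = ⟨-y, x + y, z - x * y - y ^ 2 / 2⟩) :
    (∀ a b : Heisenberg ℝ, h (a * b) = h a * h b) ∧
    Function.Bijective h ∧
    h^[6] = id ∧
    ∀ n : ℕ, 0 < n → Even n →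
      Set.BijOn h
        {a : Heisenberg ℝ | (∃ k : ℤ, a.x = n * k) ∧ (∃ k : ℤ, a.y = n * k) ∧
          (∃ k : ℤ, a.z = n * k)}
        {a : Heisenberg ℝ | (∃ k : ℤ, a.x = n * k) ∧ (∃ k : ℤ, a.y = n * k) ∧
          (∃ k : ℤ, a.z = n * k)} := by
  have hval (a : Heisenberg ℝ) :
      h a = ⟨-a.y, a.x + a.y, a.z - a.x * a.y - a.y ^ 2 / 2⟩ := hdef a.x a.y a.z
  have hcube (a : Heisenberg ℝ) : h (h (h a)) = ⟨-a.x, -a.y, a.z⟩ := by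
    simp only [hval]
    ext <;> dsimp only <;> ring
  have hsix : h^[6] = id := by
    funext a
    change h (h (h (h (h (h a))))) = a
    simp only [hcube, neg_neg]
  have hbij : Function.Bijective h := by
    refine Function.bijective_iff_has_inverse.mpr ⟨h^[5], fun a => ?_, fun a => ?_⟩
    · exact congrFun hsix a
    · rw [← Function.iterate_succ_apply' h 5 a]
      exact congrFun hsix a
  refine ⟨fun a b => ?_, hbij, hsix, fun n _ hn => ?_⟩
  · simp only [hval]
    ext <;> simp only [Heisenberg.mul_x, Heisenberg.mul_y, Heisenberg.mul_z] <;> ring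
  · obtain ⟨m, rfl⟩ := hn
    refine (fun maps => ⟨maps, hbij.injective.injOn, fun a ha =>
      ⟨h^[5] a, Set.MapsTo.iterate maps 5 ha,
        (Function.iterate_succ_apply' h 5 a).symm.trans (congrFun hsix a)⟩⟩) ?_
    rintro a ⟨⟨i, hi⟩, ⟨j, hj⟩, ⟨k, hk⟩⟩
    rw [hval]
    refine ⟨⟨-j, ?_⟩, ⟨i + j, ?_⟩, ⟨k - (m + m) * i * j - m * j ^ 2, ?_⟩⟩ <;>
      simp only [hi, hj, hk] <;> push_cast <;> ring
end

section
/- The map h' : H(ℤ) → H(ℤ) defined by h'(A(x,y,z)) = A(−y, x+y, z − xy − (y² − y)/2) is a well-defined group automorphism of the integral Heisenberg group (note that (y² − y)/2 is an integer for every integer y), and it satisfies (h')⁶ = id. -/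
theorem Int.two_mul_sq_sub_self_ediv_two (y : ℤ) : 2 * ((y ^ 2 - y) / 2) = y ^ 2 - y := by
  refine Int.mul_ediv_cancel' (even_iff_two_dvd.mp ?_)
  rw [show y ^ 2 - y = y * (y - 1) by ring]
  exact Int.even_mul_pred_self y

/-- The map `h'(A(x,y,z)) = A(−y, x+y, z − xy − (y²−y)/2)` is a well-defined
group automorphism of the integral Heisenberg group satisfying `(h')⁶ = id`.
(Here `(y² − y)/2` is integer division, which is exact since `y² − y` is even.) -/
theorem heisenberg_int_automorphism_h'
    (h : Heisenberg ℤ → Heisenberg ℤ)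
    (hdef : ∀ x y z : ℤ, h ⟨x, y, z⟩ = ⟨-y, x + y, z - x * y - (y ^ 2 - y) / 2⟩) :
    (∀ a b : Heisenberg ℤ, h (a * b) = h a * h b) ∧
    Function.Bijective h ∧
    h^[6] = id := by
  have hiter : h^[6] = id := by
    funext ⟨x, y, z⟩
    simp only [Function.iterate_succ, Function.iterate_zero, Function.comp_apply, hdef, id_eq,
      Heisenberg.mk.injEq]
    refine ⟨by ring, by ring, ?_⟩
    have h₁ := Int.two_mul_sq_sub_self_ediv_two y
    have h₂ := Int.two_mul_sq_sub_self_ediv_two (x + y)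
    have h₃ := Int.two_mul_sq_sub_self_ediv_two x
    have h₄ := Int.two_mul_sq_sub_self_ediv_two (-y)
    have h₅ := Int.two_mul_sq_sub_self_ediv_two (-(x + y))
    have h₆ := Int.two_mul_sq_sub_self_ediv_two (-x)
    rw [show -y + (x + y) = x by ring, show -(x + y) + x = -y by ring,
      show -x + -y = -(x + y) by ring, show - -y + -(x + y) = -x by ring]
    linarith
  refine ⟨?_, ?_, hiter⟩
  · rintro ⟨x₁, y₁, z₁⟩ ⟨x₂, y₂, z₂⟩
    change h ⟨x₁ + x₂, y₁ + y₂, z₁ + z₂ + x₁ * y₂⟩ = _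
    rw [hdef, hdef, hdef]
    have h₁ := Int.two_mul_sq_sub_self_ediv_two y₁
    have h₂ := Int.two_mul_sq_sub_self_ediv_two y₂
    have h₃ := Int.two_mul_sq_sub_self_ediv_two (y₁ + y₂)
    ext
    · simp only [Heisenberg.mul_x]
      ring
    · simp only [Heisenberg.mul_y]
      ring
    · simp only [Heisenberg.mul_z]
      linarith
  · exact ⟨Function.Injective.of_comp (f := h^[5]) (by
        rw [← Function.iterate_succ, hiter]; exact Function.injective_id),
      Function.Surjective.of_comp (g := h^[5]) (by
        rw [← Function.iterate_succ', hiter]; exact Function.surjective_id)⟩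
end

section
/- Let H be a nontrivial finite cyclic subgroup of SO(3,ℝ). Then the set of points of the unit sphere S² fixed by every element of H, namely {v ∈ ℝ³ : ‖v‖ = 1 and gv = v for all g ∈ H}, has exactly two elements. -/
open scoped Matrix

namespace Matrix

/-- The transpose of a `3 × 3` matrix relates the cross product of the images of two vectors
to their cross product, up to the determinant. -/
lemma transpose_mulVec_cross_mulVec {R : Type*} [CommRing R] (M : Matrix (Fin 3) (Fin 3) R)
    (u w : Fin 3 → R) :
    Mᵀ *ᵥ (crossProduct (M *ᵥ u) (M *ᵥ w)) = M.det • crossProduct u w := by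
  ext i
  fin_cases i <;>
    simp [cross_apply, mulVec, dotProduct, Fin.sum_univ_three, det_fin_three] <;> ring

/-- A matrix of `SO(3)` fixing two vectors fixes their cross product. -/
lemma mulVec_cross_eq_of_mulVec_eq {R : Type*} [CommRing R] {M : Matrix (Fin 3) (Fin 3) R}
    (hM : M * Mᵀ = 1) (hdet : M.det = 1) {u w : Fin 3 → R} (hu : M *ᵥ u = u)
    (hw : M *ᵥ w = w) : M *ᵥ (crossProduct u w) = crossProduct u w := by
  have h := transpose_mulVec_cross_mulVec M u w
  rw [hu, hw, hdet, one_smul] at h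
  conv_lhs => rw [← h]
  rw [mulVec_mulVec, hM, one_mulVec]

/-- A matrix of `SO(3)` fixing two vectors with nonzero cross product is the identity. -/
lemma eq_one_of_mulVec_eq_of_cross_dot_cross_ne_zero {K : Type*} [Field K]
    {M : Matrix (Fin 3) (Fin 3) K} (hM : M * Mᵀ = 1) (hdet : M.det = 1) {u w : Fin 3 → K}
    (hu : M *ᵥ u = u) (hw : M *ᵥ w = w)
    (hc : crossProduct u w ⬝ᵥ crossProduct u w ≠ 0) : M = 1 := by
  have hP : (of ![u, w, crossProduct u w]).det ≠ 0 := by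
    convert hc using 1
    simp [det_fin_three, cross_apply, dotProduct, Fin.sum_univ_three]
    ring
  have hPM : ∀ c, M *ᵥ c = c → of ![u, w, c] * Mᵀ = of ![u, w, c] := by
    intro c hMc
    ext i j
    fin_cases i
    · simpa [mul_apply, mulVec, dotProduct, mul_comm] using congrFun hu j
    · simpa [mul_apply, mulVec, dotProduct, mul_comm] using congrFun hw j
    · simpa [mul_apply, mulVec, dotProduct, mul_comm] using congrFun hMc j
  have hunit : IsUnit (of ![u, w, crossProduct u w]) :=
    (isUnit_iff_isUnit_det _).2 hP.isUnit
  exact transpose_eq_one.1 (hunit.mul_left_cancel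
    ((hPM _ (mulVec_cross_eq_of_mulVec_eq hM hdet hu hw)).trans (mul_one _).symm))

/-- Euler's rotation theorem: a matrix of `SO(3)` has a nonzero fixed vector. -/
lemma exists_ne_zero_mulVec_eq {K : Type*} [Field K] [CharZero K]
    {M : Matrix (Fin 3) (Fin 3) K} (hM : M * Mᵀ = 1) (hdet : M.det = 1) :
    ∃ v : Fin 3 → K, v ≠ 0 ∧ M *ᵥ v = v := by
  have h : (M - 1).det = -(M - 1).det := by
    calc (M - 1).det = (M * (1 - M)ᵀ).det := by
          rw [transpose_sub, transpose_one, mul_sub, mul_one, hM]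
      _ = (-(M - 1)).det := by rw [det_mul, hdet, one_mul, det_transpose, neg_sub]
      _ = -(M - 1).det := by rw [det_neg]; norm_num
  obtain ⟨v, hv, hv'⟩ := exists_mulVec_eq_zero_iff.2 (self_eq_neg.1 h)
  exact ⟨v, hv, by simpa [sub_mulVec, sub_eq_zero] using hv'⟩

end Matrix

/-- Two unit vectors whose cross product has zero norm are equal or opposite. -/
lemma EuclideanSpace.eq_or_eq_neg_of_cross_dot_cross_eq_zero {u w : EuclideanSpace ℝ (Fin 3)}
    (hu : ‖u‖ = 1) (hw : ‖w‖ = 1)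
    (hc : crossProduct (u : Fin 3 → ℝ) w ⬝ᵥ crossProduct (u : Fin 3 → ℝ) w = 0) :
    w = u ∨ w = -u := by
  have hdot (x y : EuclideanSpace ℝ (Fin 3)) : (x : Fin 3 → ℝ) ⬝ᵥ y = inner ℝ x y := by
    simp [PiLp.inner_apply, dotProduct, mul_comm]
  rw [cross_dot_cross, hdot, hdot, hdot, hdot, real_inner_self_eq_norm_sq,
    real_inner_self_eq_norm_sq, hu, hw, real_inner_comm] at hc
  have h : (inner ℝ w u - 1) * (inner ℝ w u + 1) = 0 := by
    rw [real_inner_comm] at hc ⊢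
    linear_combination -hc
  rcases mul_eq_zero.1 h with h | h
  · exact Or.inl ((inner_eq_one_iff_of_norm_eq_one hw hu).1 (sub_eq_zero.1 h))
  · refine Or.inr ((inner_eq_one_iff_of_norm_eq_one (𝕜 := ℝ) hw (by rwa [norm_neg])).1 ?_)
    rw [inner_neg_right]
    linarith

/-- A nontrivial finite cyclic subgroup of `SO(3,ℝ)` (realised as a subgroup of
`GL(3,ℝ)` consisting of orthogonal matrices of determinant `1`) fixes exactly
two points of the unit sphere `S² ⊆ ℝ³`. -/
theorem fixed_points_of_cyclic_subgroup_SO3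
    (H : Subgroup (Matrix.GeneralLinearGroup (Fin 3) ℝ))
    (hSO : ∀ g ∈ H, (g : Matrix (Fin 3) (Fin 3) ℝ) ∈ Matrix.orthogonalGroup (Fin 3) ℝ ∧
      (g : Matrix (Fin 3) (Fin 3) ℝ).det = 1)
    (hfin : Finite ↥H) (hcyc : IsCyclic ↥H) (hnt : H ≠ ⊥) :
    Set.ncard {v : EuclideanSpace ℝ (Fin 3) | ‖v‖ = 1 ∧
      ∀ g ∈ H, (g : Matrix (Fin 3) (Fin 3) ℝ).mulVec v = v} = 2 := by
  obtain ⟨⟨g, hgH⟩, hgen⟩ := hcyc.exists_generator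
  have hgM : (g : Matrix (Fin 3) (Fin 3) ℝ) * (g : Matrix (Fin 3) (Fin 3) ℝ)ᵀ = 1 :=
    (Matrix.mem_orthogonalGroup_iff _ _).1 (hSO g hgH).1
  have hdet := (hSO g hgH).2
  have hg1 : (g : Matrix (Fin 3) (Fin 3) ℝ) ≠ 1 := by
    intro h
    refine hnt ((Subgroup.eq_bot_iff_forall H).2 fun x hx => ?_)
    obtain ⟨n, hn⟩ := Subgroup.mem_zpowers_iff.1 (hgen ⟨x, hx⟩)
    have hg : g = 1 := Units.ext h
    have := congrArg Subtype.val hn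
    simpa [hg] using this.symm
  have hfix (v : Fin 3 → ℝ) : (∀ x ∈ H, (x : Matrix (Fin 3) (Fin 3) ℝ) *ᵥ v = v) ↔
      (g : Matrix (Fin 3) (Fin 3) ℝ) *ᵥ v = v := by
    refine ⟨fun h => h g hgH, fun h x hx => ?_⟩
    let S : Subgroup (Matrix.GeneralLinearGroup (Fin 3) ℝ) :=
      { carrier := {y | (y : Matrix (Fin 3) (Fin 3) ℝ) *ᵥ v = v}
        one_mem' := by simp
        mul_mem' := fun {a b} ha hb => by
          simp only [Set.mem_ofPred_eq] at ha hb ⊢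
          rw [Units.val_mul, ← Matrix.mulVec_mulVec, hb, ha]
        inv_mem' := fun {a} ha => by
          simp only [Set.mem_ofPred_eq] at ha ⊢
          conv_lhs => rw [← ha]
          rw [Matrix.mulVec_mulVec, Units.inv_mul, Matrix.one_mulVec] }
    obtain ⟨n, hn⟩ := Subgroup.mem_zpowers_iff.1 (hgen ⟨x, hx⟩)
    have hxn : g ^ n = x := congrArg Subtype.val hn
    exact hxn ▸ S.zpow_mem (show g ∈ S from h) n
  obtain ⟨w, hw, hgw⟩ := Matrix.exists_ne_zero_mulVec_eq hgM hdet
  have hw' : WithLp.toLp 2 w ≠ 0 := by simpa using hw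
  set u : EuclideanSpace ℝ (Fin 3) := ‖WithLp.toLp 2 w‖⁻¹ • WithLp.toLp 2 w with hu_def
  have hu : ‖u‖ = 1 := norm_smul_inv_norm (𝕜 := ℝ) hw'
  have hgu : (g : Matrix (Fin 3) (Fin 3) ℝ) *ᵥ u = u := by
    simp [hu_def, Matrix.mulVec_smul, hgw]
  rw [Set.ncard_eq_two]
  refine ⟨u, -u, ?_, ?_⟩
  · intro h
    have : IsAddTorsionFree (EuclideanSpace ℝ (Fin 3)) := .of_module_rat _
    simp [self_eq_neg.1 h] at hu
  · ext v
    simp only [Set.mem_ofPred_eq, Set.mem_insert_iff, Set.mem_singleton_iff]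
    rw [hfix]
    constructor
    · rintro ⟨hv, hgv⟩
      refine EuclideanSpace.eq_or_eq_neg_of_cross_dot_cross_eq_zero hu hv ?_
      by_contra hc
      exact hg1 (Matrix.eq_one_of_mulVec_eq_of_cross_dot_cross_ne_zero hgM hdet hgu hgv hc)
    · rintro (rfl | rfl)
      · exact ⟨hu, hgu⟩
      · exact ⟨by rwa [norm_neg], by simp [Matrix.mulVec_neg, hgu]⟩
end

section
/- Let H be a nontrivial finite subgroup of SO(3,ℝ). Then there exists a nontrivial cyclic subgroup H' of H such that at least one of the following holds: (1) φ(H') = H' for every automorphism φ of H (i.e. H' is a characteristic subgroup of H); or (2) the set Σ_H(H') = {φ(H') : φ ∈ Aut(H)} has at most 12 elements, the fixed-point set {v ∈ ℝ³ : ‖v‖ = 1 and gv = v for all g ∈ H'} consists of exactly two points p ≠ q, and there exists h ∈ H with hH'h⁻¹ = H', hp = q and hq = p. -/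
section Rotations

open Matrix

/-- The real `3 × 3` rotation matrices. -/
def IsRotation (A : Matrix (Fin 3) (Fin 3) ℝ) : Prop :=
  A ∈ orthogonalGroup (Fin 3) ℝ ∧ A.det = 1

namespace IsRotation

variable {A : Matrix (Fin 3) (Fin 3) ℝ} {p q : Fin 3 → ℝ}

theorem transpose_mul_self (hA : IsRotation A) : Aᵀ * A = 1 :=
  (mem_orthogonalGroup_iff' _ _).1 hA.1

theorem mul_transpose_self (hA : IsRotation A) : A * Aᵀ = 1 :=
  (mem_orthogonalGroup_iff _ _).1 hA.1

theorem dotProduct_mulVec (hA : IsRotation A) (v w : Fin 3 → ℝ) :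
    (A *ᵥ v) ⬝ᵥ (A *ᵥ w) = v ⬝ᵥ w := by
  rw [Matrix.dotProduct_mulVec, ← mulVec_transpose, mulVec_mulVec, hA.transpose_mul_self,
    one_mulVec]

theorem adjugate_eq (hA : IsRotation A) : A.adjugate = Aᵀ := by
  have h := A.adjugate_mul
  rw [hA.2, one_smul] at h
  calc A.adjugate = A.adjugate * (A * Aᵀ) := by rw [hA.mul_transpose_self, mul_one]
    _ = Aᵀ := by rw [← mul_assoc, h, one_mul]

theorem cross_mulVec (hA : IsRotation A) (v w : Fin 3 → ℝ) :
    (A *ᵥ v) ⨯₃ (A *ᵥ w) = A *ᵥ (v ⨯₃ w) := by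
  have h : A = A.adjugateᵀ := by rw [hA.adjugate_eq, transpose_transpose]
  conv_rhs => rw [h, adjugate_fin_three]
  ext i
  fin_cases i <;>
    simp [cross_apply, mulVec, dotProduct, Fin.sum_univ_three] <;> ring

theorem eq_one_of_mulVec_eq (hA : IsRotation A) (hp : A *ᵥ p = p) (hq : A *ᵥ q = q)
    (hpq : p ⨯₃ q ≠ 0) : A = 1 := by
  have hc : A *ᵥ (p ⨯₃ q) = p ⨯₃ q := by rw [← hA.cross_mulVec, hp, hq]
  set M : Matrix (Fin 3) (Fin 3) ℝ := ![p ⨯₃ q, p, q] with hM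
  have hdet : IsUnit M.det := by
    rw [isUnit_iff_ne_zero, hM, ← triple_product_eq_det]
    exact fun h => hpq (dotProduct_self_eq_zero.1 h)
  have hMA : M * Aᵀ = M := by
    ext i j
    have : (M * Aᵀ) i j = (A *ᵥ M i) j := by
      simp [mul_apply, mulVec, dotProduct, mul_comm]
    rw [this]
    fin_cases i
    · exact congrFun hc j
    · exact congrFun hp j
    · exact congrFun hq j
  have : Aᵀ = 1 := by
    calc Aᵀ = M⁻¹ * (M * Aᵀ) := by rw [← mul_assoc, nonsing_inv_mul _ hdet, one_mul]
      _ = 1 := by rw [hMA, nonsing_inv_mul _ hdet]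
  rw [← transpose_transpose A, this, transpose_one]

theorem exists_mulVec_eq (hA : IsRotation A) : ∃ p, p ⬝ᵥ p = 1 ∧ A *ᵥ p = p := by
  have hdet : (A - 1).det = 0 := by
    have h1 : A - 1 = A * -(A - 1)ᵀ := by
      rw [transpose_sub, transpose_one, mul_neg, mul_sub, hA.mul_transpose_self, mul_one, neg_sub]
    have h2 := congrArg det h1
    rw [det_mul, hA.2, one_mul, det_neg, det_transpose] at h2
    norm_num at h2
    linarith
  obtain ⟨v, hv, hAv⟩ := exists_mulVec_eq_zero_iff.2 hdet
  rw [sub_mulVec, one_mulVec, sub_eq_zero] at hAv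
  have hpos : 0 < v ⬝ᵥ v :=
    lt_of_le_of_ne (Finset.sum_nonneg fun i _ => mul_self_nonneg (v i))
      fun h => hv (dotProduct_self_eq_zero.1 h.symm)
  refine ⟨(√(v ⬝ᵥ v))⁻¹ • v, ?_, by rw [mulVec_smul, hAv]⟩
  rw [smul_dotProduct, dotProduct_smul, smul_eq_mul, smul_eq_mul, ← mul_assoc, ← mul_inv,
    Real.mul_self_sqrt hpos.le, inv_mul_cancel₀ hpos.ne']

theorem eq_or_eq_neg (hA : IsRotation A) (hA1 : A ≠ 1) (hp : p ⬝ᵥ p = 1) (hq : q ⬝ᵥ q = 1)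
    (hAp : A *ᵥ p = p) (hAq : A *ᵥ q = q) : q = p ∨ q = -p := by
  have hc : p ⨯₃ q = 0 := by
    by_contra h
    exact hA1 (hA.eq_one_of_mulVec_eq hAp hAq h)
  have hqp : q = (p ⬝ᵥ q) • p := by
    have h := cross_cross_eq_smul_sub_smul p q p
    rw [hc, hp, one_smul, dotProduct_comm q p] at h
    simpa [sub_eq_zero] using h.symm
  have hsq : (p ⬝ᵥ q) * (p ⬝ᵥ q) = 1 := by
    have h := cross_dot_cross p q p q
    rw [hc, hp, hq, dotProduct_comm q p] at h
    simp at h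
    linarith
  rcases mul_self_eq_one_iff.1 hsq with h | h
  · left; rwa [h, one_smul] at hqp
  · right; rwa [h, neg_one_smul] at hqp

end IsRotation

theorem exists_unit_dotProduct_eq_zero (p : Fin 3 → ℝ) : ∃ u, u ⬝ᵥ u = 1 ∧ p ⬝ᵥ u = 0 := by
  obtain ⟨v, hv, hpv⟩ : ∃ v : Fin 3 → ℝ, v ≠ 0 ∧ p ⬝ᵥ v = 0 := by
    by_cases h : p 0 = 0
    · refine ⟨![1, 0, 0], fun h0 => by simpa using congrFun h0 0, ?_⟩
      simp [dotProduct, Fin.sum_univ_three, h]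
    · refine ⟨![-p 1, p 0, 0], fun h0 => h (by simpa using congrFun h0 1), ?_⟩
      simp [dotProduct, Fin.sum_univ_three]
      ring
  have hpos : 0 < v ⬝ᵥ v :=
    lt_of_le_of_ne (Finset.sum_nonneg fun i _ => mul_self_nonneg (v i))
      fun h => hv (dotProduct_self_eq_zero.1 h.symm)
  refine ⟨(√(v ⬝ᵥ v))⁻¹ • v, ?_, by rw [dotProduct_smul, hpv, smul_zero]⟩
  rw [smul_dotProduct, dotProduct_smul, smul_eq_mul, smul_eq_mul, ← mul_assoc, ← mul_inv,
    Real.mul_self_sqrt hpos.le, inv_mul_cancel₀ hpos.ne']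

/-- If `p`, `u` are orthonormal, every vector orthogonal to `p` is a combination of `u` and
`p ⨯₃ u`. -/
theorem eq_smul_add_smul_cross {p u x : Fin 3 → ℝ} (hp : p ⬝ᵥ p = 1) (hu : u ⬝ᵥ u = 1)
    (hpu : p ⬝ᵥ u = 0) (hpx : p ⬝ᵥ x = 0) :
    x = (u ⬝ᵥ x) • u + ((p ⨯₃ u) ⬝ᵥ x) • (p ⨯₃ u) := by
  have h1 : x ⨯₃ (p ⨯₃ u) = (u ⬝ᵥ x) • p := by
    rw [cross_cross_eq_smul_sub_smul', hpx, zero_smul, sub_zero, dotProduct_comm x u]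
  have h2 : p ⨯₃ (p ⨯₃ u) = -u := by
    rw [cross_cross_eq_smul_sub_smul', hpu, hp, zero_smul, one_smul, zero_sub]
  have h3 : (p ⨯₃ u) ⬝ᵥ (p ⨯₃ u) = 1 := by
    rw [cross_dot_cross, hp, hu, hpu]
    simp
  have h4 := cross_cross_eq_smul_sub_smul x (p ⨯₃ u) (p ⨯₃ u)
  rw [h1, h3, one_smul, map_smul, LinearMap.smul_apply, h2, dotProduct_comm x] at h4
  rw [smul_neg] at h4
  rw [← sub_eq_zero] at h4 ⊢
  rw [← h4]
  abel

/-- A finite group of rotations about a common axis is cyclic. -/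
theorem isCyclic_of_rotations_fixing {G : Type*} [Group G] [Finite G]
    (f : G →* Matrix (Fin 3) (Fin 3) ℝ) (hf : Function.Injective f)
    (hrot : ∀ g, IsRotation (f g)) {p : Fin 3 → ℝ} (hp : p ⬝ᵥ p = 1)
    (hfix : ∀ g, f g *ᵥ p = p) : IsCyclic G := by
  obtain ⟨u, hu, hpu⟩ := exists_unit_dotProduct_eq_zero p
  have hperp : ∀ g, p ⬝ᵥ (f g *ᵥ u) = 0 := fun g => by
    rw [← hpu, ← (hrot g).dotProduct_mulVec p u, hfix]
  have hdecomp := fun g => eq_smul_add_smul_cross hp hu hpu (hperp g)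
  have hcross : ∀ g, f g *ᵥ (p ⨯₃ u) = p ⨯₃ (f g *ᵥ u) := fun g => by
    rw [← (hrot g).cross_mulVec, hfix]
  have hc1 : ∀ x, u ⬝ᵥ (p ⨯₃ x) = -((p ⨯₃ u) ⬝ᵥ x) := fun x => by
    simp [cross_apply, dotProduct, Fin.sum_univ_three]; ring
  have hc2 : ∀ x, (p ⨯₃ u) ⬝ᵥ (p ⨯₃ x) = u ⬝ᵥ x := fun x => by
    rw [cross_dot_cross, hp, dotProduct_comm u p, hpu]; ring
  let χ : G →* ℂ :=
    { toFun := fun g => ⟨u ⬝ᵥ (f g *ᵥ u), (p ⨯₃ u) ⬝ᵥ (f g *ᵥ u)⟩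
      map_one' := by
        apply Complex.ext
        · simp [hu]
        · simp [dotProduct_comm, dot_cross_self]
      map_mul' := fun g h => by
        have key : f (g * h) *ᵥ u = (u ⬝ᵥ (f h *ᵥ u)) • (f g *ᵥ u) +
            ((p ⨯₃ u) ⬝ᵥ (f h *ᵥ u)) • (p ⨯₃ (f g *ᵥ u)) := by
          rw [map_mul, ← mulVec_mulVec, ← hcross, ← mulVec_smul, ← mulVec_smul, ← mulVec_add,
            ← hdecomp h]
        apply Complex.ext
        · rw [Complex.mul_re]
          simp only [key, dotProduct_add, dotProduct_smul, hc1, smul_eq_mul]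
          ring
        · rw [Complex.mul_im]
          simp only [key, dotProduct_add, dotProduct_smul, hc2, smul_eq_mul]
          ring }
  refine isCyclic_of_injective_ringHom χ ((injective_iff_map_eq_one χ).2 fun g hg => ?_)
  have hre : u ⬝ᵥ (f g *ᵥ u) = 1 := congrArg Complex.re hg
  have him : (p ⨯₃ u) ⬝ᵥ (f g *ᵥ u) = 0 := congrArg Complex.im hg
  have hgu : f g *ᵥ u = u := by
    have := hdecomp g
    rwa [hre, him, one_smul, zero_smul, add_zero] at this
  refine hf ?_
  rw [map_one]
  refine (hrot g).eq_one_of_mulVec_eq (hfix g) hgu fun h => ?_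
  have := cross_dot_cross p u p u
  rw [h, hp, hu, hpu] at this
  simp at this

end Rotations

/-- The arithmetic classification of the stabilizer orders `r₁ ≤ r₂ ≤ r₃` of three orbits of
sizes `a₁, a₂, a₃`. -/
theorem stabilizer_orders {N a₁ a₂ a₃ r₁ r₂ r₃ : ℕ} (h₁ : a₁ * r₁ = N) (h₂ : a₂ * r₂ = N)
    (h₃ : a₃ * r₃ = N) (hsum : a₁ + a₂ + a₃ = N + 2) (hr : 2 ≤ r₁) (h12 : r₁ ≤ r₂)
    (h23 : r₂ ≤ r₃) :
    r₁ = 2 ∧ (r₂ = 2 ∧ a₃ = 2 ∨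
      r₂ = 3 ∧ (r₃ = 3 ∧ a₁ = 6 ∨ r₃ = 4 ∧ a₃ = 6 ∨ r₃ = 5 ∧ a₃ = 12)) := by
  have k₁ : ∀ m, m ≤ r₁ → a₁ * m ≤ N := fun m hm => h₁ ▸ Nat.mul_le_mul_left _ hm
  have k₂ : ∀ m, m ≤ r₂ → a₂ * m ≤ N := fun m hm => h₂ ▸ Nat.mul_le_mul_left _ hm
  have k₃ : ∀ m, m ≤ r₃ → a₃ * m ≤ N := fun m hm => h₃ ▸ Nat.mul_le_mul_left _ hm
  obtain rfl : r₁ = 2 := by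
    by_contra h
    have := k₁ 3 (by omega); have := k₂ 3 (by omega); have := k₃ 3 (by omega)
    omega
  have hr₂ : r₂ < 4 := by
    by_contra h
    have := k₂ 4 (by omega); have := k₃ 4 (by omega)
    omega
  refine ⟨rfl, ?_⟩
  obtain rfl | rfl : r₂ = 2 ∨ r₂ = 3 := by omega
  · left; omega
  · have hr₃ : r₃ < 6 := by
      by_contra h
      have := k₃ 6 (by omega)
      omega
    interval_cases r₃ <;> omega

section AntipodalActions

open MulAction

variable {G P : Type*} [Group G] [MulAction G P]

theorem ncard_orbit_mul_card_stabilizer (p : P) :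
    (orbit G p).ncard * Nat.card (stabilizer G p) = Nat.card G := by
  rw [← index_stabilizer, Subgroup.index_mul_card]

theorem card_stabilizer_smul [Finite P] (g : G) (p : P) :
    Nat.card (stabilizer G (g • p)) = Nat.card (stabilizer G p) := by
  have h1 := ncard_orbit_mul_card_stabilizer (G := G) p
  have h2 := ncard_orbit_mul_card_stabilizer (G := G) (g • p)
  rw [orbit_smul, ← h1] at h2
  exact Nat.eq_of_mul_eq_mul_left ((Set.ncard_pos (Set.toFinite _)).2 ⟨p, mem_orbit_self p⟩) h2

/-- Burnside's lemma when all nontrivial elements have exactly two fixed points. -/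
theorem card_add_two_mul_eq_card_orbits_mul [Finite G] [Finite P]
    (hfix : ∀ g : G, g ≠ 1 → (fixedBy P g).ncard = 2) :
    Nat.card P + 2 * (Nat.card G - 1) = Nat.card (orbitRel.Quotient G P) * Nat.card G := by
  classical
  have := Fintype.ofFinite G
  have := Fintype.ofFinite P
  have := Fintype.ofFinite (orbitRel.Quotient G P)
  have h := sum_card_fixedBy_eq_card_orbits_mul_card_group G P
  rw [Nat.card_eq_fintype_card, Nat.card_eq_fintype_card, Nat.card_eq_fintype_card, ← h,
    ← Finset.add_sum_erase _ _ (Finset.mem_univ (1 : G))]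
  congr 1
  · simp [fixedBy]
  · rw [Finset.sum_congr rfl (g := fun _ => 2)]
    · simp [Finset.card_erase_of_mem, mul_comm]
    · intro g hg
      rw [← hfix g (Finset.ne_of_mem_erase hg), ← Nat.card_coe_set_eq, Nat.card_eq_fintype_card]

theorem card_eq_sum_ncard_orbit [Finite P] [Fintype (orbitRel.Quotient G P)] :
    Nat.card P = ∑ ω : orbitRel.Quotient G P, (orbit G ω.out).ncard := by
  rw [Nat.card_congr (selfEquivSigmaOrbits G P), Nat.card_sigma]
  rfl

variable {neg : P → P}

/-- A point whose stabilizer order divides only the stabilizer orders of the points of its own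
orbit is exchanged with its antipode. -/
theorem exists_flip_of_forall_dvd_mem_orbit [Finite P]
    (hstab : ∀ p : P, stabilizer G (neg p) = stabilizer G p) {p : P} {n : ℕ}
    (hp : ∀ q : P, Nat.card (stabilizer G p) ∣ Nat.card (stabilizer G q) → q ∈ orbit G p)
    (hcard : (orbit G p).ncard ≤ n) :
    (∃ h : G, h • p = neg p) ∧
      {q : P | Nat.card (stabilizer G p) ∣ Nat.card (stabilizer G q)}.ncard ≤ n ∧
      ∀ q : P, Nat.card (stabilizer G p) ∣ Nat.card (stabilizer G q) →
        Nat.card (stabilizer G q) = Nat.card (stabilizer G p) := by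
  refine ⟨hp (neg p) (by rw [hstab]),
    (Set.ncard_le_ncard (fun q hq => hp q hq) (Set.toFinite _)).trans hcard, fun q hq => ?_⟩
  obtain ⟨g, rfl⟩ := hp q hq
  exact card_stabilizer_smul g p

/-- A point with an orbit of size two is exchanged with its antipode. -/
theorem exists_flip_of_ncard_orbit_eq_two
    (hfix : ∀ (p q : P) (g : G), g ≠ 1 → g • p = p → g • q = q → q = p ∨ q = neg p)
    {p : P} (hp : stabilizer G p ≠ ⊥) (hcard : (orbit G p).ncard = 2) :
    ∃ h : G, h • p = neg p := by
  have hnormal : (stabilizer G p).Normal :=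
    Subgroup.normal_of_index_eq_two (by rw [index_stabilizer, hcard])
  obtain ⟨q, ⟨h, rfl⟩, hq⟩ := Set.exists_ne_of_one_lt_ncard (by omega : 1 < (orbit G p).ncard) p
  obtain ⟨g, hg, hg1⟩ := (Subgroup.bot_or_exists_ne_one _).resolve_left hp
  have hconj := hnormal.conj_mem g hg h⁻¹
  rw [inv_inv, mem_stabilizer_iff, mul_smul, mul_smul, inv_smul_eq_iff] at hconj
  exact ⟨h, (hfix p (h • p) g hg1 hg hconj).resolve_left hq⟩

theorem exists_flip_of_three_orbits [Finite G] [Finite P]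
    (hstab : ∀ p : P, stabilizer G (neg p) = stabilizer G p)
    (hfix : ∀ (p q : P) (g : G), g ≠ 1 → g • p = p → g • q = q → q = p ∨ q = neg p)
    (htwo : ∀ p : P, 2 ≤ Nat.card (stabilizer G p)) (p₁ p₂ p₃ : P)
    (hcover : ∀ q : P, q ∈ orbit G p₁ ∨ q ∈ orbit G p₂ ∨ q ∈ orbit G p₃)
    (hsum : (orbit G p₁).ncard + (orbit G p₂).ncard + (orbit G p₃).ncard = Nat.card G + 2)
    (hcard : Nat.card P = Nat.card G + 2)
    (h12 : Nat.card (stabilizer G p₁) ≤ Nat.card (stabilizer G p₂))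
    (h23 : Nat.card (stabilizer G p₂) ≤ Nat.card (stabilizer G p₃)) :
    ∃ p : P, (∃ h : G, h • p = neg p) ∧
      {q : P | Nat.card (stabilizer G p) ∣ Nat.card (stabilizer G q)}.ncard ≤ 12 ∧
      ∀ q : P, Nat.card (stabilizer G p) ∣ Nat.card (stabilizer G q) →
        Nat.card (stabilizer G q) = Nat.card (stabilizer G p) := by
  have e₃ := ncard_orbit_mul_card_stabilizer (G := G) p₃
  obtain ⟨r₁, h⟩ := stabilizer_orders (ncard_orbit_mul_card_stabilizer p₁)
    (ncard_orbit_mul_card_stabilizer p₂) e₃ hsum (htwo p₁) h12 h23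
  have hr : ∀ q, q ∈ orbit G p₁ ∧ Nat.card (stabilizer G q) = Nat.card (stabilizer G p₁) ∨
      q ∈ orbit G p₂ ∧ Nat.card (stabilizer G q) = Nat.card (stabilizer G p₂) ∨
      q ∈ orbit G p₃ ∧ Nat.card (stabilizer G q) = Nat.card (stabilizer G p₃) := by
    intro q
    refine (hcover q).imp ?_ (Or.imp ?_ ?_) <;>
    · rintro ⟨g, rfl⟩
      exact ⟨mem_orbit _ g, card_stabilizer_smul g _⟩
  have hthird (h3 : ¬ Nat.card (stabilizer G p₃) ∣ Nat.card (stabilizer G p₁))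
      (h3' : ¬ Nat.card (stabilizer G p₃) ∣ Nat.card (stabilizer G p₂)) (q : P)
      (hq : Nat.card (stabilizer G p₃) ∣ Nat.card (stabilizer G q)) : q ∈ orbit G p₃ := by
    rcases hr q with ⟨-, e⟩ | ⟨-, e⟩ | ⟨h, -⟩
    · exact absurd (e ▸ hq) h3
    · exact absurd (e ▸ hq) h3'
    · exact h
  rcases h with ⟨r₂, a₃⟩ | ⟨r₂, ⟨r₃, a₁⟩ | ⟨r₃, a₃⟩ | ⟨r₃, a₃⟩⟩
  · by_cases r₃ : Nat.card (stabilizer G p₃) = 2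
    · refine ⟨p₃, exists_flip_of_ncard_orbit_eq_two hfix (fun h => ?_) a₃,
        (Set.ncard_le_card _).trans ?_, fun q _ => ?_⟩
      · rw [h, Subgroup.card_bot] at r₃
        omega
      · rw [a₃, r₃] at e₃
        omega
      · rcases hr q with ⟨-, e⟩ | ⟨-, e⟩ | ⟨-, e⟩ <;> omega
    · have := htwo p₃
      have hnd : ¬ Nat.card (stabilizer G p₃) ∣ 2 := fun h => by
        have := Nat.le_of_dvd two_pos h
        omega
      exact ⟨p₃, exists_flip_of_forall_dvd_mem_orbit hstab
        (hthird (r₁ ▸ hnd) (r₂ ▸ hnd)) (by omega)⟩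
  · refine ⟨p₁, exists_flip_of_forall_dvd_mem_orbit hstab (fun q hq => ?_) (by omega)⟩
    rcases hr q with ⟨h, -⟩ | ⟨-, e⟩ | ⟨-, e⟩
    · exact h
    · rw [e, r₁, r₂] at hq; omega
    · rw [e, r₁, r₃] at hq; omega
  · exact ⟨p₃, exists_flip_of_forall_dvd_mem_orbit hstab
      (hthird (by rw [r₁, r₃]; decide) (by rw [r₂, r₃]; decide)) (by omega)⟩
  · exact ⟨p₃, exists_flip_of_forall_dvd_mem_orbit hstab
      (hthird (by rw [r₁, r₃]; decide) (by rw [r₂, r₃]; decide)) (by omega)⟩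

/-- Let a finite group act on a finite set with an involution `neg`, such that the fixed points of
each nontrivial element are two antipodal points. Then either some point is fixed by the whole
group, or some point is exchanged with its antipode and its stabilizer order divides that of at
most twelve points, all of the same stabilizer order. -/
theorem exists_stabilizer_eq_top_or_flip [Finite G] [Finite P] [Nontrivial G] [Nonempty P]
    (hneg : ∀ p, neg p ≠ p)
    (hnegsmul : ∀ (g : G) (p : P), g • p = p → g • neg p = neg p)
    (hnegneg : ∀ p, neg (neg p) = p)
    (hfix : ∀ (p q : P) (g : G), g ≠ 1 → g • p = p → g • q = q → q = p ∨ q = neg p)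
    (hex : ∀ g : G, ∃ p : P, g • p = p) (hpole : ∀ p : P, ∃ g : G, g ≠ 1 ∧ g • p = p) :
    ∃ p : P, stabilizer G p = ⊤ ∨ (∃ h : G, h • p = neg p) ∧
      {q : P | Nat.card (stabilizer G p) ∣ Nat.card (stabilizer G q)}.ncard ≤ 12 ∧
      ∀ q : P, Nat.card (stabilizer G p) ∣ Nat.card (stabilizer G q) →
        Nat.card (stabilizer G q) = Nat.card (stabilizer G p) := by
  classical
  have hstab : ∀ p : P, stabilizer G (neg p) = stabilizer G p := fun p => by
    ext g
    exact ⟨fun h => by simpa [hnegneg] using hnegsmul g _ h, fun h => hnegsmul g p h⟩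
  have htwo : ∀ p : P, 2 ≤ Nat.card (stabilizer G p) := fun p => by
    obtain ⟨g, hg1, hg⟩ := hpole p
    have : Nontrivial (stabilizer G p) :=
      ⟨⟨g, hg⟩, 1, fun h => hg1 (congrArg Subtype.val h)⟩
    exact Finite.one_lt_card
  have hburnside := card_add_two_mul_eq_card_orbits_mul (G := G) (P := P) fun g hg => by
    obtain ⟨p, hp⟩ := hex g
    rw [← Set.ncard_pair (hneg p).symm]
    congr 1
    ext q
    refine ⟨fun hq => hfix p q g hg hp hq, ?_⟩
    rintro (rfl | rfl)
    · exact hp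
    · exact hnegsmul g p hp
  have := Fintype.ofFinite (orbitRel.Quotient G P)
  have hPsum := card_eq_sum_ncard_orbit (G := G) (P := P)
  have hN : 1 < Nat.card G := Finite.one_lt_card
  have hP : 1 < Nat.card P :=
    have := nontrivial_of_ne _ _ (hneg (Classical.arbitrary P))
    Finite.one_lt_card
  have hle : 2 * Nat.card P ≤ Nat.card (orbitRel.Quotient G P) * Nat.card G := by
    rw [hPsum, Nat.card_eq_fintype_card (α := orbitRel.Quotient G P), Finset.mul_sum,
      ← smul_eq_mul (Fintype.card _), ← Finset.card_univ]
    refine Finset.sum_le_card_nsmul _ _ _ fun ω _ => ?_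
    rw [← ncard_orbit_mul_card_stabilizer (G := G) ω.out, mul_comm]
    exact Nat.mul_le_mul_left _ (htwo _)
  have hk : Nat.card (orbitRel.Quotient G P) = 2 ∨ Nat.card (orbitRel.Quotient G P) = 3 := by
    have h4 : Nat.card (orbitRel.Quotient G P) < 4 := by
      by_contra h
      have := Nat.mul_le_mul_right (Nat.card G) (not_lt.1 h)
      omega
    generalize Nat.card (orbitRel.Quotient G P) = k at *
    interval_cases k <;> omega
  have hmem : ∀ q : P, q ∈ orbit G (Quotient.mk'' q : orbitRel.Quotient G P).out := fun q =>
    orbitRel_apply.1 ((orbitRel G P).symm (Quotient.mk_out (s := orbitRel G P) q))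
  rcases hk with hk | hk
  · rw [hk] at hburnside
    rw [Nat.card_eq_fintype_card, ← Finset.card_univ, Finset.card_eq_two] at hk
    obtain ⟨x, y, hxy, huniv⟩ := hk
    rw [huniv, Finset.sum_pair hxy] at hPsum
    have hpos : ∀ p : P, 0 < (orbit G p).ncard := fun p =>
      (Set.ncard_pos (Set.toFinite _)).2 ⟨p, mem_orbit_self p⟩
    have hx := hpos x.out
    have hy := hpos y.out
    have hone : (orbit G x.out).ncard = 1 := by omega
    refine ⟨x.out, Or.inl ?_⟩
    rw [← Subgroup.index_eq_one, index_stabilizer, hone]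
  · rw [hk] at hburnside
    rw [Nat.card_eq_fintype_card, ← Finset.card_univ, Finset.card_eq_three] at hk
    obtain ⟨x, y, z, hxy, hxz, hyz, huniv⟩ := hk
    rw [huniv, Finset.sum_insert (by simp [hxy, hxz]), Finset.sum_pair hyz] at hPsum
    have hcover : ∀ q : P, q ∈ orbit G x.out ∨ q ∈ orbit G y.out ∨ q ∈ orbit G z.out := by
      intro q
      have h : (Quotient.mk'' q : orbitRel.Quotient G P) ∈ ({x, y, z} : Finset _) :=
        huniv ▸ Finset.mem_univ _
      simp only [Finset.mem_insert, Finset.mem_singleton] at h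
      rcases h with h | h | h <;> rw [← h]
      exacts [.inl (hmem q), .inr (.inl (hmem q)), .inr (.inr (hmem q))]
    have main := exists_flip_of_three_orbits (G := G) hstab hfix htwo
    have hc : Nat.card P = Nat.card G + 2 := by omega
    have sort : ∃ p₁ p₂ p₃ : P,
        (∀ q, q ∈ orbit G p₁ ∨ q ∈ orbit G p₂ ∨ q ∈ orbit G p₃) ∧
        (orbit G p₁).ncard + (orbit G p₂).ncard + (orbit G p₃).ncard = Nat.card G + 2 ∧
        Nat.card (stabilizer G p₁) ≤ Nat.card (stabilizer G p₂) ∧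
        Nat.card (stabilizer G p₂) ≤ Nat.card (stabilizer G p₃) := by
      rcases le_total (Nat.card (stabilizer G x.out)) (Nat.card (stabilizer G y.out)) with h1 | h1 <;>
      rcases le_total (Nat.card (stabilizer G y.out)) (Nat.card (stabilizer G z.out)) with h2 | h2 <;>
      rcases le_total (Nat.card (stabilizer G x.out)) (Nat.card (stabilizer G z.out)) with h3 | h3
      · exact ⟨_, _, _, hcover, by omega, h1, h2⟩
      · exact ⟨_, _, _, hcover, by omega, h1, h2⟩
      · exact ⟨x.out, z.out, y.out, fun q => by have := hcover q; tauto, by omega, h3, h2⟩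
      · exact ⟨z.out, x.out, y.out, fun q => by have := hcover q; tauto, by omega, h3, h1⟩
      · exact ⟨y.out, x.out, z.out, fun q => by have := hcover q; tauto, by omega, h1, h3⟩
      · exact ⟨y.out, z.out, x.out, fun q => by have := hcover q; tauto, by omega, h2, h3⟩
      · exact ⟨z.out, y.out, x.out, fun q => by have := hcover q; tauto, by omega, h2, h1⟩
      · exact ⟨z.out, y.out, x.out, fun q => by have := hcover q; tauto, by omega, h2, h1⟩
    obtain ⟨p₁, p₂, p₃, hcov, hs, h12, h23⟩ := sort
    obtain ⟨p, hp⟩ := main p₁ p₂ p₃ hcov hs hc h12 h23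
    exact ⟨p, Or.inr hp⟩

/-- If stabilizers are cyclic and nontrivial elements have fixed points, automorphisms map a
nontrivial stabilizer into a stabilizer. -/
theorem exists_map_stabilizer_eq [Finite G] (hex : ∀ g : G, ∃ p : P, g • p = p) {p : P}
    [IsCyclic (stabilizer G p)]
    (hp : ∀ q : P, Nat.card (stabilizer G p) ∣ Nat.card (stabilizer G q) →
      Nat.card (stabilizer G q) = Nat.card (stabilizer G p)) (φ : G ≃* G) :
    ∃ q : P, Nat.card (stabilizer G p) ∣ Nat.card (stabilizer G q) ∧
      stabilizer G q = (stabilizer G p).map φ.toMonoidHom := by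
  obtain ⟨g, hg⟩ := (Subgroup.isCyclic_iff_exists_zpowers_eq_top (stabilizer G p)).1 ‹_›
  obtain ⟨q, hq⟩ := hex (φ g)
  have hle : (stabilizer G p).map φ.toMonoidHom ≤ stabilizer G q := by
    rw [← hg, MonoidHom.map_zpowers, Subgroup.zpowers_le]
    exact hq
  have hcard : Nat.card ((stabilizer G p).map φ.toMonoidHom) = Nat.card (stabilizer G p) :=
    Subgroup.card_map_of_injective φ.injective
  have hdvd : Nat.card (stabilizer G p) ∣ Nat.card (stabilizer G q) :=
    hcard ▸ Subgroup.card_dvd_of_le hle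
  exact ⟨q, hdvd, (Subgroup.eq_of_le_of_card_ge hle (by rw [hcard, hp q hdvd])).symm⟩

end AntipodalActions

open Matrix MulAction in
/-- Every nontrivial finite subgroup `H` of `SO(3,ℝ)` has a nontrivial cyclic
subgroup `H'` which is either characteristic in `H`, or such that `H'` has at
most `12` images under automorphisms of `H`, the fixed-point set of `H'` on the
unit sphere consists of exactly two points `p ≠ q`, and some `h ∈ H`
normalising `H'` exchanges `p` and `q`. -/
theorem cyclic_subgroup_of_finite_SO3_subgroup
    (H : Subgroup (Matrix.GeneralLinearGroup (Fin 3) ℝ))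
    (hSO : ∀ g ∈ H, (g : Matrix (Fin 3) (Fin 3) ℝ) ∈ Matrix.orthogonalGroup (Fin 3) ℝ ∧
      (g : Matrix (Fin 3) (Fin 3) ℝ).det = 1)
    (hfin : Finite ↥H) (hnt : H ≠ ⊥) :
    ∃ H' : Subgroup ↥H, H' ≠ ⊥ ∧ IsCyclic ↥H' ∧
      ((∀ φ : ↥H ≃* ↥H, H'.map φ.toMonoidHom = H') ∨
        (Set.ncard {K : Subgroup ↥H | ∃ φ : ↥H ≃* ↥H, K = H'.map φ.toMonoidHom} ≤ 12 ∧
          ∃ p q : EuclideanSpace ℝ (Fin 3), p ≠ q ∧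
            {v : EuclideanSpace ℝ (Fin 3) | ‖v‖ = 1 ∧
              ∀ g : ↥H, g ∈ H' → ((g : Matrix.GeneralLinearGroup (Fin 3) ℝ) :
                Matrix (Fin 3) (Fin 3) ℝ).mulVec v = v} = {p, q} ∧
            ∃ h : ↥H, (∀ x : ↥H, x ∈ H' ↔ h * x * h⁻¹ ∈ H') ∧
              ((h : Matrix.GeneralLinearGroup (Fin 3) ℝ) :
                Matrix (Fin 3) (Fin 3) ℝ).mulVec p = q ∧
              ((h : Matrix.GeneralLinearGroup (Fin 3) ℝ) :
                Matrix (Fin 3) (Fin 3) ℝ).mulVec q = p)) := by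
  let f : ↥H →* Matrix (Fin 3) (Fin 3) ℝ := (Units.coeHom _).comp H.subtype
  have hf : Function.Injective f := Units.val_injective.comp Subtype.val_injective
  have hrot : ∀ g, IsRotation (f g) := fun g => hSO g g.2
  have hf1 : ∀ g, g ≠ 1 → f g ≠ 1 := fun g hg h => hg (hf (h.trans (map_one f).symm))
  let isPole : (Fin 3 → ℝ) → Prop := fun v => v ⬝ᵥ v = 1 ∧ ∃ g : ↥H, g ≠ 1 ∧ f g *ᵥ v = v
  let P := {v : Fin 3 → ℝ // isPole v}
  have hsmul : ∀ (g : ↥H) (v : Fin 3 → ℝ), isPole v → isPole (f g *ᵥ v) := by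
    rintro g v ⟨hv, k, hk, hkv⟩
    refine ⟨by rw [(hrot g).dotProduct_mulVec, hv], g * k * g⁻¹, ?_, ?_⟩
    · rwa [Ne, conj_eq_one_iff]
    · rw [Matrix.mulVec_mulVec, ← map_mul, inv_mul_cancel_right, map_mul, ← Matrix.mulVec_mulVec,
        hkv]
  have hnegPole : ∀ v, isPole v → isPole (-v) := by
    rintro v ⟨hv, k, hk, hkv⟩
    exact ⟨by rw [neg_dotProduct_neg, hv], k, hk, by rw [Matrix.mulVec_neg, hkv]⟩
  let _ : MulAction ↥H P :=
    { smul := fun g v => ⟨f g *ᵥ v.1, hsmul g v.1 v.2⟩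
      one_smul := fun v => Subtype.ext (by
        change f 1 *ᵥ v.1 = v.1
        rw [map_one, Matrix.one_mulVec])
      mul_smul := fun g h v => Subtype.ext (by
        change f (g * h) *ᵥ v.1 = f g *ᵥ (f h *ᵥ v.1)
        rw [map_mul, Matrix.mulVec_mulVec]) }
  have hsmul_iff : ∀ (g : ↥H) (v w : P), g • v = w ↔ f g *ᵥ v.1 = w.1 := fun g v w => Subtype.ext_iff
  let neg : P → P := fun v => ⟨-v.1, hnegPole v.1 v.2⟩
  have hneg : ∀ p, neg p ≠ p := fun p h => by
    have h0 : p.1 = 0 := self_eq_neg.1 (congrArg Subtype.val h).symm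
    have := p.2.1
    rw [h0] at this
    simp at this
  have hnegsmul : ∀ (g : ↥H) (p q : P), g • p = q → g • neg p = neg q := fun g p q h => by
    rw [hsmul_iff] at h ⊢
    rw [Matrix.mulVec_neg, h]
  have hnegneg : ∀ p, neg (neg p) = p := fun p => Subtype.ext (neg_neg p.1)
  have hfix : ∀ (p q : P) (g : ↥H), g ≠ 1 → g • p = p → g • q = q → q = p ∨ q = neg p := by
    intro p q g hg hp hq
    rw [hsmul_iff] at hp hq
    exact ((hrot g).eq_or_eq_neg (hf1 g hg) p.2.1 q.2.1 hp hq).imp Subtype.ext Subtype.ext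
  have hex' : ∀ g : ↥H, g ≠ 1 → ∃ p : P, g • p = p := fun g hg => by
    obtain ⟨p, hp, hgp⟩ := (hrot g).exists_mulVec_eq
    exact ⟨⟨p, hp, g, hg, hgp⟩, Subtype.ext hgp⟩
  have : Nontrivial ↥H := H.nontrivial_iff_ne_bot.2 hnt
  have : Nonempty P := by
    obtain ⟨g, hg⟩ := exists_ne (1 : ↥H)
    exact (hex' g hg).nonempty
  have hex : ∀ g : ↥H, ∃ p : P, g • p = p := fun g => by
    obtain rfl | hg := eq_or_ne g 1
    · exact ⟨Classical.arbitrary P, one_smul _ _⟩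
    · exact hex' g hg
  have hpole : ∀ p : P, ∃ g : ↥H, g ≠ 1 ∧ g • p = p := fun p => by
    obtain ⟨g, hg, hgp⟩ := p.2.2
    exact ⟨g, hg, Subtype.ext hgp⟩
  have : Finite P := by
    choose a ha using hex
    refine Set.finite_univ_iff.1 ((Set.finite_range a |>.union
      (Set.finite_range fun g => neg (a g))).subset fun p _ => ?_)
    obtain ⟨g, hg, hgp⟩ := hpole p
    exact (hfix _ p g hg (ha g) hgp).imp (fun h => ⟨g, h.symm⟩) fun h => ⟨g, h.symm⟩
  have hcyc : ∀ p : P, IsCyclic (stabilizer ↥H p) := fun p =>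
    isCyclic_of_rotations_fixing (f.comp (stabilizer ↥H p).subtype)
      (hf.comp Subtype.val_injective) (fun g => hrot g) p.2.1
      fun g => (hsmul_iff g p p).1 g.2
  obtain ⟨p, hp⟩ := exists_stabilizer_eq_top_or_flip (G := ↥H) hneg
    (fun g p h => hnegsmul g p p h) hnegneg hfix hex hpole
  obtain ⟨g, hg1, hg⟩ := hpole p
  refine ⟨stabilizer ↥H p, fun h => hg1 (by rwa [← mem_stabilizer_iff, h, Subgroup.mem_bot] at hg),
    hcyc p, hp.imp (fun htop φ => ?_) ?_⟩
  · rw [htop]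
    exact Subgroup.map_top_of_surjective _ φ.surjective
  rintro ⟨⟨h, hh⟩, hcard, hdvd⟩
  have hhneg : h • neg p = p := by rw [hnegsmul h p _ hh, hnegneg]
  refine ⟨?_, WithLp.toLp 2 p.1, WithLp.toLp 2 (-p.1), fun hpn => ?_, ?_, h, fun x => ?_,
    (hsmul_iff h p (neg p)).1 hh, (hsmul_iff h (neg p) p).1 hhneg⟩
  · refine (Set.ncard_le_ncard ?_ (Set.toFinite _)).trans ((Set.ncard_image_le
      (f := fun q => stabilizer ↥H q) (Set.toFinite _)).trans hcard)
    rintro K ⟨φ, rfl⟩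
    have := hcyc p
    exact exists_map_stabilizer_eq hex hdvd φ
  · exact hneg p (Subtype.ext (WithLp.toLp_injective 2 hpn).symm)
  · have hnorm : ∀ v : EuclideanSpace ℝ (Fin 3), ‖v‖ = 1 ↔ v.ofLp ⬝ᵥ v.ofLp = 1 := fun v => by
      rw [← pow_eq_one_iff_of_nonneg (norm_nonneg v) two_ne_zero, EuclideanSpace.real_norm_sq_eq]
      simp [dotProduct, sq]
    ext v
    constructor
    · rintro ⟨hv, hfixv⟩
      rw [hnorm] at hv
      have hgv : f g *ᵥ v.ofLp = v.ofLp := hfixv g hg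
      exact (hfix p ⟨v.ofLp, hv, g, hg1, hgv⟩ g hg1 hg (Subtype.ext hgv)).imp
        (fun h => congrArg (WithLp.toLp 2) (congrArg Subtype.val h))
        (fun h => congrArg (WithLp.toLp 2) (congrArg Subtype.val h))
    · rintro (rfl | rfl)
      · exact ⟨(hnorm _).2 p.2.1, fun k hk => (hsmul_iff k p p).1 hk⟩
      · exact ⟨(hnorm _).2 (neg p).2.1,
          fun k hk => (hsmul_iff k (neg p) (neg p)).1 (hnegsmul k p p hk)⟩
  · have hinv : h⁻¹ • p = neg p := by rw [inv_smul_eq_iff, hhneg]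
    rw [mem_stabilizer_iff, mem_stabilizer_iff, mul_smul, mul_smul, hinv, smul_eq_iff_eq_inv_smul h, hinv]
    exact ⟨hnegsmul x p p, fun hx => by simpa [hnegneg] using hnegsmul x _ _ hx⟩
end

section
/- Let Γ be a finite group and Γ₀ a subgroup of Γ contained in the center Z(Γ) such that Γ/Γ₀ is abelian and the commutator subgroup [Γ, Γ] is cyclic. Then |[Γ, Γ]|² ≤ |Γ/Γ₀|. -/
open scoped commutatorElement IsMulCommutative

/-- The commutator pairing of a group of nilpotency class at most two, with values in the center. -/
def commutatorPairing {G : Type*} [Group G] (h : commutator G ≤ Subgroup.center G) :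
    G →* G →* Subgroup.center G :=
  have hc (x y : G) : ⁅x, y⁆ ∈ Subgroup.center G :=
    h (Subgroup.commutator_mem_commutator (Subgroup.mem_top x) (Subgroup.mem_top y))
  MonoidHom.mk'
    (fun x ↦ MonoidHom.mk' (fun y ↦ ⟨⁅x, y⁆, hc x y⟩) fun y z ↦ Subtype.ext <| by
      have e := Subgroup.mem_center_iff.1 (hc x z) y
      calc ⁅x, y * z⁆ = ⁅x, y⁆ * (y * ⁅x, z⁆) * y⁻¹ := by simp only [commutatorElement_def]; group
        _ = ⁅x, y⁆ * ⁅x, z⁆ := by rw [e]; group)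
    fun x y ↦ MonoidHom.ext fun z ↦ Subtype.ext <| by
      have e := Subgroup.mem_center_iff.1 (hc y z) x
      have e' := Subgroup.mem_center_iff.1 (hc y z) ⁅x, z⁆
      calc ⁅x * y, z⁆ = (x * ⁅y, z⁆) * x⁻¹ * ⁅x, z⁆ := by simp only [commutatorElement_def]; group
        _ = ⁅y, z⁆ * ⁅x, z⁆ := by rw [e]; group
        _ = ⁅x, z⁆ * ⁅y, z⁆ := e'.symm

theorem coe_commutatorPairing {G : Type*} [Group G] (h : commutator G ≤ Subgroup.center G)
    (x y : G) : (commutatorPairing h x y : G) = ⁅x, y⁆ := rfl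

theorem pow_ne_one_of_coprime {M : Type*} [Monoid M] {z : M} {q u : ℕ} (hz : z ≠ 1)
    (hq : z ^ q = 1) (hu : q.Coprime u) : z ^ u ≠ 1 := fun h ↦
  hz <| by simpa [hu.gcd_eq_one] using pow_gcd_eq_one.2 ⟨hq, h⟩

/-- If a bimultiplicative pairing is killed by `n`, but not by `n / p` for any prime `p ∣ n`,
then some single value of it has order `n`. -/
theorem exists_orderOf_pairing_eq {G M : Type*} [Group G] [CommGroup M] (B : G →* G →* M)
    {n : ℕ} (hn : 0 < n) (hB : ∀ x y, B x y ^ n = 1)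
    (hp : ∀ p : ℕ, p.Prime → p ∣ n → ∃ x y, B x y ^ (n / p) ≠ 1) :
    ∃ a b, orderOf (B a b) = n := by
  have hpow {x y : G} {m : ℕ} (h : n ∣ m) : B x y ^ m = 1 := by
    obtain ⟨c, rfl⟩ := h
    rw [pow_mul, hB, one_pow]
  have key (S : Finset ℕ) : (∀ p ∈ S, p.Prime ∧ p ∣ n) →
      ∃ a b, ∀ p ∈ S, B a b ^ (n / p) ≠ 1 := by
    induction S using Finset.induction_on with
    | empty => exact fun _ ↦ ⟨1, 1, by simp⟩
    | insert p S hpS ih =>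
      intro hS
      obtain ⟨a, b, hab⟩ := ih fun q hq ↦ hS q (Finset.mem_insert_of_mem hq)
      obtain ⟨pp, hpn⟩ := hS p (Finset.mem_insert_self p S)
      obtain ⟨x, y, hxy⟩ := hp p pp hpn
      obtain ⟨k, r, hr, hkr⟩ := Nat.exists_eq_pow_mul_and_not_dvd hn.ne' p pp.ne_one
      have hval : B (a ^ p ^ k * x ^ r) (b ^ p ^ k * y ^ r) =
          B a b ^ (p ^ k * p ^ k) * B x y ^ (r * r) := by
        have h₁ : (B a y ^ p ^ k) ^ r = 1 := by
          rw [← pow_mul]; exact hpow ⟨1, by rw [hkr]; ring⟩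
        have h₂ : (B x b ^ r) ^ p ^ k = 1 := by
          rw [← pow_mul]; exact hpow ⟨1, by rw [hkr]; ring⟩
        simp only [map_mul, map_pow, MonoidHom.mul_apply, MonoidHom.pow_apply, mul_pow, h₁, h₂,
          pow_mul, mul_one, one_mul]
      have hroot {q : ℕ} (hq : q ∣ n) (u v : G) : (B u v ^ (n / q)) ^ q = 1 := by
        rw [← pow_mul, Nat.div_mul_cancel hq, hB]
      have hkill {q s : ℕ} (hq : q ∣ n) (hs : q ∣ s) (u v : G) :
          (B u v ^ (s * s)) ^ (n / q) = 1 := by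
        obtain ⟨c, rfl⟩ := hs
        rw [← pow_mul]
        refine hpow ⟨c * (q * c), ?_⟩
        calc q * c * (q * c) * (n / q) = (n / q * q) * (c * (q * c)) := by ring
          _ = n * (c * (q * c)) := by rw [Nat.div_mul_cancel hq]
      refine ⟨a ^ p ^ k * x ^ r, b ^ p ^ k * y ^ r, fun q hq ↦ ?_⟩
      obtain ⟨qp, hqn⟩ := hS q hq
      rw [hval, mul_pow]
      rcases Finset.mem_insert.1 hq with rfl | hqS
      · have hk : q ∣ q ^ k := by
          rcases (qp.dvd_mul).1 (hkr ▸ hqn) with h | h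
          exacts [h, (hr h).elim]
        have hc := (qp.coprime_iff_not_dvd).2 hr
        rw [hkill hqn hk, one_mul, pow_right_comm]
        exact pow_ne_one_of_coprime hxy (hroot hqn x y) (hc.mul_right hc)
      · have hqp : q ≠ p := fun h ↦ hpS (h ▸ hqS)
        have hc : q.Coprime (p ^ k) := ((Nat.coprime_primes qp pp).2 hqp).pow_right k
        have hqr : q ∣ r := hc.dvd_of_dvd_mul_left (hkr ▸ hqn)
        rw [hkill hqn hqr, mul_one, pow_right_comm]
        exact pow_ne_one_of_coprime (hab q hqS) (hroot hqn a b) (hc.mul_right hc)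
  obtain ⟨a, b, hab⟩ := key n.primeFactors fun p h ↦
    ⟨Nat.prime_of_mem_primeFactors h, Nat.dvd_of_mem_primeFactors h⟩
  exact ⟨a, b, orderOf_eq_of_pow_and_pow_div_prime hn (hB a b) fun p pp hpn ↦
    hab p (pp.mem_primeFactors hpn hn.ne')⟩

/-- In a finite group of class at most two with cyclic commutator subgroup, some commutator
generates the commutator subgroup. -/
theorem exists_orderOf_commutatorPairing_eq {G : Type*} [Group G] [Finite G]
    (h : commutator G ≤ Subgroup.center G) [IsCyclic (commutator G)] :
    ∃ a b, orderOf (commutatorPairing h a b) = Nat.card (commutator G) := by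
  have hmem (x y : G) : ⁅x, y⁆ ∈ commutator G :=
    Subgroup.commutator_mem_commutator (Subgroup.mem_top x) (Subgroup.mem_top y)
  refine exists_orderOf_pairing_eq _ Nat.card_pos (fun x y ↦ Subtype.ext ?_) fun p pp hpn ↦ ?_
  · have e := pow_card_eq_one' (x := (⟨⁅x, y⁆, hmem x y⟩ : commutator G))
    rw [Subgroup.coe_pow, coe_commutatorPairing]
    simpa only [Subgroup.coe_pow, Subgroup.coe_one] using congrArg Subtype.val e
  · by_contra! hall
    have hle : commutator G ≤
        (powMonoidHom (α := Subgroup.center G) (Nat.card (commutator G) / p)).ker.map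
          (Subgroup.center G).subtype := by
      rw [commutator_def, Subgroup.commutator_le]
      exact fun x _ y _ ↦ ⟨commutatorPairing h x y, hall x y, rfl⟩
    obtain ⟨g, hg⟩ := IsCyclic.exists_ofOrder_eq_natCard (α := commutator G)
    obtain ⟨z, hz, hzg⟩ := hle g.2
    have hg1 : g ^ (Nat.card (commutator G) / p) = 1 := Subtype.ext <| by
      have hz' : z ^ (Nat.card (commutator G) / p) = 1 := hz
      rw [Subgroup.coe_pow, ← hzg, ← map_pow, hz', map_one, Subgroup.coe_one]
    have hdvd := orderOf_dvd_of_pow_eq_one hg1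
    rw [hg] at hdvd
    exact (Nat.div_lt_self Nat.card_pos pp.one_lt).not_ge
      (Nat.le_of_dvd (Nat.div_pos (Nat.le_of_dvd Nat.card_pos hpn) pp.pos) hdvd)

/-- If `Γ` is a finite group, `Γ₀` a central subgroup with `Γ/Γ₀` abelian, and
`[Γ,Γ]` is cyclic, then `|[Γ,Γ]|² ≤ |Γ/Γ₀|`. -/
theorem sq_card_commutator_le_card_quotient
    {Γ : Type*} [Group Γ] [Finite Γ] (Γ₀ : Subgroup Γ) [Γ₀.Normal]
    (hcent : Γ₀ ≤ Subgroup.center Γ)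
    (hab : commutator Γ ≤ Γ₀)
    (hcyc : IsCyclic ↥(commutator Γ)) :
    Nat.card ↥(commutator Γ) ^ 2 ≤ Nat.card (Γ ⧸ Γ₀) := by
  have h := hab.trans hcent
  obtain ⟨a, b, hord⟩ := exists_orderOf_commutatorPairing_eq h
  set n := Nat.card (commutator Γ)
  set B := commutatorPairing h
  have hself (x : Γ) : B x x = 1 := Subtype.ext (commutatorElement_self x)
  have hleft {z : Γ} (hz : z ∈ Γ₀) (x : Γ) : B z x = 1 := Subtype.ext <|
    commutatorElement_eq_one_iff_mul_comm.2 (Subgroup.mem_center_iff.1 (hcent hz) x).symm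
  have hright {z : Γ} (hz : z ∈ Γ₀) (x : Γ) : B x z = 1 := Subtype.ext <|
    commutatorElement_eq_one_iff_mul_comm.2 (Subgroup.mem_center_iff.1 (hcent hz) x)
  have hinj : Function.Injective
      fun ij : Fin n × Fin n ↦ ((a ^ (ij.1 : ℕ) * b ^ (ij.2 : ℕ) : Γ) : Γ ⧸ Γ₀) := by
    rintro ⟨i, j⟩ ⟨i', j'⟩ hij
    have hz := QuotientGroup.eq.1 hij
    have hi := hleft hz b
    have hj := hright hz a
    simp only [map_mul, map_inv, map_pow, MonoidHom.mul_apply, MonoidHom.inv_apply,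
      MonoidHom.pow_apply, hself, one_pow, mul_one, one_mul, inv_mul_eq_one] at hi hj
    have hpow := pow_injOn_Iio_orderOf (x := B a b)
    rw [hord] at hpow
    exact Prod.ext (Fin.ext (hpow i.2 i'.2 hi)) (Fin.ext (hpow j.2 j'.2 hj))
  simpa [sq] using Nat.card_le_card_of_injective _ hinj
end

section
/- Let Γ be a finite group and Γ₀ a subgroup of Γ contained in the center Z(Γ) such that Γ/Γ₀ is abelian and the commutator subgroup [Γ, Γ] is cyclic. If |Γ/Γ₀| divides |[Γ, Γ]|, then Γ is abelian. -/
open scoped commutatorElement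

section CentralCommutator

variable {G : Type*} [Group G]

open Subgroup

theorem commutatorElement_pow_right_of_mem_center {a b : G} (h : ⁅a, b⁆ ∈ center G) (n : ℕ) :
    ⁅a, b ^ n⁆ = ⁅a, b⁆ ^ n := by
  have hc : Commute ⁅a, b⁆ b := (mem_center_iff.mp h b).symm
  have hconj : a * b * a⁻¹ = ⁅a, b⁆ * b := by simp [commutatorElement_def]
  rw [commutatorElement_def a (b ^ n), ← conj_pow, hconj, hc.mul_pow, mul_inv_cancel_right]

theorem commutatorElement_pow_left_of_mem_center {a b : G} (h : ⁅a, b⁆ ∈ center G) (n : ℕ) :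
    ⁅a ^ n, b⁆ = ⁅a, b⁆ ^ n := by
  have h' : ⁅b, a⁆ ∈ center G := by
    rw [← commutatorElement_inv]
    exact inv_mem h
  rw [← commutatorElement_inv, commutatorElement_pow_right_of_mem_center h', ← inv_pow,
    commutatorElement_inv]

theorem orderOf_commutatorElement_mul_self_dvd_index {H : Subgroup G} [H.Normal]
    (hcent : H ≤ center G) (hab : commutator G ≤ H) (a b : G) :
    orderOf ⁅a, b⁆ * orderOf ⁅a, b⁆ ∣ H.index := by
  have hc : ⁅a, b⁆ ∈ center G :=
    hcent (hab (commutator_mem_commutator (mem_top a) (mem_top b)))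
  let K := centralizer ({a} : Set G)
  have hHK : H ≤ K := hcent.trans (center_le_centralizer _)
  have haK : a ∈ K := mem_centralizer_singleton_iff.mpr rfl
  have : K.Normal := Normal.of_commutator_le G (hab.trans hHK)
  rw [← relIndex_mul_index hHK]
  refine mul_dvd_mul (orderOf_dvd_of_pow_eq_one ?_) (orderOf_dvd_of_pow_eq_one ?_)
  · have hmem : a ^ H.relIndex K ∈ H := pow_index_mem (H.subgroupOf K) ⟨a, haK⟩
    rw [← commutatorElement_pow_left_of_mem_center hc, commutatorElement_eq_one_iff_mul_comm]
    exact (mem_center_iff.mp (hcent hmem) b).symm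
  · have hmem : b ^ K.index ∈ K := pow_index_mem K b
    rw [← commutatorElement_pow_right_of_mem_center hc, commutatorElement_eq_one_iff_mul_comm]
    exact (mem_centralizer_singleton_iff.mp hmem).symm

end CentralCommutator

theorem Nat.Prime.dvd_of_mul_self_dvd_mul {p o m : ℕ} (hp : p.Prime) (h : o * o ∣ p * m) :
    o ∣ m := by
  obtain ⟨t, ht⟩ := h
  have hdvd : p ∣ o * o * t := ⟨m, ht.symm⟩
  rcases hp.dvd_mul.mp hdvd with h | ⟨s, rfl⟩
  · obtain ⟨s, hs⟩ : p ∣ o := (hp.dvd_mul.mp h).elim id id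
    refine ⟨s * t, Nat.eq_of_mul_eq_mul_left hp.pos ?_⟩
    calc p * m = o * o * t := ht
      _ = p * s * o * t := by rw [← hs]
      _ = p * (o * (s * t)) := by ring
  · refine ⟨o * s, Nat.eq_of_mul_eq_mul_left hp.pos ?_⟩
    rw [ht]
    ring

/-- If `Γ` is a finite group, `Γ₀` a central subgroup with `Γ/Γ₀` abelian,
`[Γ,Γ]` is cyclic, and `|Γ/Γ₀|` divides `|[Γ,Γ]|`, then `Γ` is abelian. -/
theorem abelian_of_card_quotient_dvd_card_commutator
    {Γ : Type*} [Group Γ] [Finite Γ] (Γ₀ : Subgroup Γ) [Γ₀.Normal]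
    (hcent : Γ₀ ≤ Subgroup.center Γ)
    (hab : commutator Γ ≤ Γ₀)
    (hcyc : IsCyclic ↥(commutator Γ))
    (hdvd : Nat.card (Γ ⧸ Γ₀) ∣ Nat.card ↥(commutator Γ)) :
    ∀ a b : Γ, a * b = b * a := by
  have hone : Nat.card ↥(commutator Γ) = 1 := by
    by_contra hne
    obtain ⟨p, hp, m, hm⟩ := Nat.exists_prime_and_dvd hne
    have hcomm : ∀ a b : Γ, ⁅a, b⁆ ^ m = 1 := fun a b => by
      refine orderOf_dvd_iff_pow_eq_one.mp (hp.dvd_of_mul_self_dvd_mul ?_)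
      rw [← hm]
      exact (orderOf_commutatorElement_mul_self_dvd_index hcent hab a b).trans hdvd
    have hpow : ∀ x ∈ commutator Γ, x ^ m = 1 := by
      intro x hx
      rw [commutator_eq_closure] at hx
      induction hx using Subgroup.closure_induction with
      | mem x hx =>
        obtain ⟨a, b, rfl⟩ := hx
        exact hcomm a b
      | one => exact one_pow m
      | mul x y hx _ ihx ihy =>
        rw [← commutator_eq_closure] at hx
        have hxy : Commute x y := (Subgroup.mem_center_iff.mp (hcent (hab hx)) y).symm
        rw [hxy.mul_pow, ihx, ihy, one_mul]
      | inv x _ ihx => rw [inv_pow, ihx, inv_one]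
    obtain ⟨g, hg⟩ := IsCyclic.exists_ofOrder_eq_natCard (α := ↥(commutator Γ))
    have hdvd_m : p * m ∣ m := by
      rw [← hm, ← hg]
      exact orderOf_dvd_of_pow_eq_one (Subtype.ext (hpow g g.2))
    have hm_pos : 0 < m := Nat.pos_of_mul_pos_left (hm ▸ Nat.card_pos)
    have := Nat.le_of_dvd hm_pos hdvd_m
    nlinarith [hp.two_le]
  intro a b
  rw [← commutatorElement_eq_one_iff_mul_comm]
  have hmem : ⁅a, b⁆ ∈ commutator Γ :=
    Subgroup.commutator_mem_commutator (Subgroup.mem_top a) (Subgroup.mem_top b)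
  rwa [Subgroup.card_eq_one.mp hone, Subgroup.mem_bot] at hmem
end
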